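/- For Q ∈ Sp(2): Re(Q₀₀) = 1 if and only if Q = [[1, 0], [0, d]] for some d ∈ ℍ with ‖d‖ = 1; and Re(Q₀₀) = −1 if and only if Q = [[−1, 0], [0, d]] for some d ∈ ℍ with ‖d‖ = 1. In particular, the critical set of F (the set where Im(Q₀₀) = 0 and Q₀₁ = 0) is the union of these two sets, and each of the two focal varieties M_{±1} = F⁻¹(±1) is diffeomorphic to the unit quaternions S³. -/

import Mathlib

noncomputable section
open Matrix

/-- The real quaternions. -/
abbrev H : Type := Quaternion ℝ

/-- `Sp(2)`, the quaternionic unitary group `{Q | Q Qᴴ = 1}`. -/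
def Sp2 : Set (Matrix (Fin 2) (Fin 2) H) := {Q | Q * Qᴴ = 1}

/-- A block-diagonal matrix `[[s, 0], [0, d]]` with `s = ±1` and `‖d‖ = 1` lies in `Sp(2)`. -/
theorem diag_mem_Sp2 {s : ℝ} (hs : s ^ 2 = 1) {d : H} (hd : ‖d‖ = 1) :
    !![(s : H), 0; 0, d] ∈ Sp2 := by
  have hd' : d * star d = 1 := by
    rw [Quaternion.self_mul_star, Quaternion.normSq_eq_norm_mul_self, hd]; simp
  have hs' : (s : H) * (s : H) = 1 := by
    rw [← Quaternion.coe_mul, ← sq, hs, Quaternion.coe_one]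
  change _ * _ = _
  ext1 i j
  fin_cases i <;> fin_cases j <;>
    simp [Matrix.mul_apply, Fin.sum_univ_two, Matrix.conjTranspose_apply, hd', hs']

theorem normSq_row_of_mem_Sp2 {Q : Matrix (Fin 2) (Fin 2) H} (hQ : Q ∈ Sp2) (i : Fin 2) :
    Quaternion.normSq (Q i 0) + Quaternion.normSq (Q i 1) = 1 := by
  have h : Q * Qᴴ = 1 := hQ
  have hi := congrFun (congrFun h i) i
  simp only [Matrix.mul_apply, Fin.sum_univ_two, Matrix.conjTranspose_apply,
    Quaternion.self_mul_star, Matrix.one_apply_eq] at hi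
  rw [← Quaternion.coe_add, ← Quaternion.coe_one] at hi
  exact Quaternion.coe_injective hi

theorem rows_orthogonal_of_mem_Sp2 {Q : Matrix (Fin 2) (Fin 2) H} (hQ : Q ∈ Sp2) :
    Q 1 0 * star (Q 0 0) + Q 1 1 * star (Q 0 1) = 0 := by
  have h : Q * Qᴴ = 1 := hQ
  simpa [Matrix.mul_apply, Fin.sum_univ_two] using congrFun (congrFun h 1) 0

/-- The level sets of `Re Q₀₀` at `s = ±1` consist of the matrices `[[s, 0], [0, d]]`. -/
theorem re_eq_iff_of_mem_Sp2 {s : ℝ} (hs : s ^ 2 = 1) {Q : Matrix (Fin 2) (Fin 2) H}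
    (hQ : Q ∈ Sp2) :
    (Q 0 0).re = s ↔ ∃ d : H, ‖d‖ = 1 ∧ Q = !![(s : H), 0; 0, d] := by
  constructor
  · intro h
    have h0 := normSq_row_of_mem_Sp2 hQ 0
    have h1 := normSq_row_of_mem_Sp2 hQ 1
    have hnn : 0 ≤ Quaternion.normSq (Q 0 1) := Quaternion.normSq_nonneg
    have hdef := Quaternion.normSq_def' (Q 0 0)
    rw [h, hs] at hdef
    have hI : (Q 0 0).imI = 0 := by
      nlinarith [sq_nonneg (Q 0 0).imI, sq_nonneg (Q 0 0).imJ, sq_nonneg (Q 0 0).imK]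
    have hJ : (Q 0 0).imJ = 0 := by
      nlinarith [sq_nonneg (Q 0 0).imI, sq_nonneg (Q 0 0).imJ, sq_nonneg (Q 0 0).imK]
    have hK : (Q 0 0).imK = 0 := by
      nlinarith [sq_nonneg (Q 0 0).imI, sq_nonneg (Q 0 0).imJ, sq_nonneg (Q 0 0).imK]
    have h00 : Q 0 0 = (s : H) := by
      ext <;> simp [h, hI, hJ, hK]
    have h01 : Q 0 1 = 0 := by
      rw [← Quaternion.normSq_eq_zero]
      rw [hI, hJ, hK] at hdef
      linarith
    have hs0 : (s : H) ≠ 0 := by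
      intro hs0
      have : s = 0 := Quaternion.coe_injective (hs0.trans Quaternion.coe_zero.symm)
      simp [this] at hs
    have h10 : Q 1 0 = 0 := by
      have := rows_orthogonal_of_mem_Sp2 hQ
      simpa [h00, h01, hs0] using this
    refine ⟨Q 1 1, ?_, ?_⟩
    · rw [h10, map_zero, zero_add, Quaternion.normSq_eq_norm_mul_self] at h1
      nlinarith [norm_nonneg (Q 1 1)]
    · rw [← h00, ← h01, Matrix.eta_fin_two Q]
      simp [h01, h10]
  · rintro ⟨d, -, rfl⟩
    simp

/-- At a point of `Sp(2)`, `Im Q₀₀ = 0` and `Q₀₁ = 0` exactly when `Re Q₀₀ = ±1`. -/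
theorem critical_iff_of_mem_Sp2 {Q : Matrix (Fin 2) (Fin 2) H} (hQ : Q ∈ Sp2) :
    (Q 0 0).im = 0 ∧ Q 0 1 = 0 ↔ (Q 0 0).re = 1 ∨ (Q 0 0).re = -1 := by
  rw [← sq_eq_one_iff]
  constructor
  · rintro ⟨him, h01⟩
    have h0 := normSq_row_of_mem_Sp2 hQ 0
    rw [← Quaternion.re_add_im (Q 0 0), him, h01, add_zero, map_zero, add_zero,
      Quaternion.normSq_coe] at h0
    exact h0
  · intro h
    obtain ⟨d, -, hd⟩ := (re_eq_iff_of_mem_Sp2 h hQ).1 rfl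
    constructor
    · rw [congrFun (congrFun hd 0) 0]; simp
    · rw [congrFun (congrFun hd 0) 1]; simp

/-- The focal variety `Re Q₀₀ = s`, `s = ±1`, is homeomorphic to the unit quaternions through
its lower right entry. -/
def focalHomeomorph {s : ℝ} (hs : s ^ 2 = 1) :
    {Q : Matrix (Fin 2) (Fin 2) H // Q ∈ Sp2 ∧ (Q 0 0).re = s} ≃ₜ Metric.sphere (0 : H) 1 where
  toFun Q := ⟨Q.1 1 1, by
    obtain ⟨d, hd, hQ⟩ := (re_eq_iff_of_mem_Sp2 hs Q.2.1).1 Q.2.2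
    simp [hQ, hd]⟩
  invFun d := ⟨!![(s : H), 0; 0, d.1], diag_mem_Sp2 hs (mem_sphere_zero_iff_norm.1 d.2), by simp⟩
  left_inv Q := by
    obtain ⟨d, hd, hQ⟩ := (re_eq_iff_of_mem_Sp2 hs Q.2.1).1 Q.2.2
    ext1
    simp [hQ]
  right_inv d := by simp
  continuous_toFun := (continuous_subtype_val.matrix_elem 1 1).subtype_mk _
  continuous_invFun := by
    refine Continuous.subtype_mk (continuous_matrix fun i j => ?_) _
    fin_cases i <;> fin_cases j <;> simp <;> fun_prop

/-- For `Q ∈ Sp(2)`: `Re Q₀₀ = 1` iff `Q = [[1,0],[0,d]]` with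
`‖d‖ = 1`, and `Re Q₀₀ = −1` iff `Q = [[−1,0],[0,d]]` with `‖d‖ = 1`.  In
particular the critical set of `F(Q) = Re Q₀₀` (where `Im Q₀₀ = 0` and
`Q₀₁ = 0`) is the union of the two focal varieties `F⁻¹(±1)`, each of which is
homeomorphic (indeed diffeomorphic) to the unit quaternions `S³`. -/
theorem focal_varieties_of_F :
    (∀ Q ∈ Sp2, ((Q 0 0).re = 1 ↔ ∃ d : H, ‖d‖ = 1 ∧ Q = !![1, 0; 0, d])) ∧
    (∀ Q ∈ Sp2, ((Q 0 0).re = -1 ↔ ∃ d : H, ‖d‖ = 1 ∧ Q = !![-1, 0; 0, d])) ∧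
    {Q ∈ Sp2 | (Q 0 0).im = 0 ∧ Q 0 1 = 0} =
      {Q ∈ Sp2 | (Q 0 0).re = 1} ∪ {Q ∈ Sp2 | (Q 0 0).re = -1} ∧
    Nonempty
      (({Q : Matrix (Fin 2) (Fin 2) H // Q ∈ Sp2 ∧ (Q 0 0).re = 1}) ≃ₜ
        Metric.sphere (0 : H) 1) ∧
    Nonempty
      (({Q : Matrix (Fin 2) (Fin 2) H // Q ∈ Sp2 ∧ (Q 0 0).re = -1}) ≃ₜ
        Metric.sphere (0 : H) 1) := by
  refine ⟨fun Q hQ => ?_, fun Q hQ => ?_, ?_, ⟨focalHomeomorph (by norm_num)⟩,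
    ⟨focalHomeomorph (by norm_num)⟩⟩
  · simpa using re_eq_iff_of_mem_Sp2 (s := 1) (by norm_num) hQ
  · simpa using re_eq_iff_of_mem_Sp2 (s := -1) (by norm_num) hQ
  · ext Q
    simp only [Set.mem_union, Set.mem_ofPred_eq, ← and_or_left]
    exact and_congr_right critical_iff_of_mem_Sp2
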